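/- Let (ΩR, d) be an N-dimensional differential calculus on R and σ a degree-preserving automorphism of ΩR commuting with d. Let S = ΩR[z;σ], A = R[z;σ], and σ̄(ω z^n) = (−1)^{|ω|} σ(ω) z^n. On the trivial extension ΩA = S ⊕ S^{σ̄}, the map d(ω z^n, ν z^m) = (d(ω) z^n, (−1)^{|ω|} ω ∂_z(z^n) + d(ν) z^m), where ∂_z is the formal derivative, satisfies d² = 0 and the graded Leibniz rule with respect to the grading |(ω z^n, 0)| = |ω|, |(0, ν z^m)| = |ν| + 1; hence (ΩA, d) is an (N+1)-dimensional differential calculus on A. -/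

import Mathlib

/-!
STATEMENT 12: Let `(ΩR, d)` be an `N`-dimensional differential calculus on `R` and `σ` a
degree-preserving automorphism of `ΩR` commuting with `d`.  Let `S = ΩR[z;σ]`,
`A = R[z;σ]`, and `σ̄(ω zⁿ) = (−1)^{|ω|} σ(ω) zⁿ`.  On the trivial extension
`ΩA = S ⊕ S^{σ̄}`, the map
`d(ω zⁿ, ν z^m) = (d(ω) zⁿ, (−1)^{|ω|} ω ∂_z(zⁿ) + d(ν) z^m)` satisfies `d² = 0` and the
graded Leibniz rule with respect to the grading `|(ω zⁿ, 0)| = |ω|`,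
`|(0, ν z^m)| = |ν| + 1`; hence `(ΩA, d)` is an `(N+1)`-dimensional differential calculus
on `A`.

Encoding: `Ω` is a graded `F`-algebra with grading `𝒜`; `S` is the skew polynomial ring
`ΩR[z;σ]` (via `ι`, `z`, the skew relation and unique representation); `σ̄` is the algebra
automorphism of `S` with `σ̄(ι(ω) zⁿ) = (−1)^{|ω|} ι(σ ω) zⁿ`; the trivial extension is
`S × S` with multiplication `(s,m)(s',m') = (ss', sm' + m σ̄(s'))`, graded by
`Ω^k A = S_k × S_{k−1}` where `S_j = span{ι(ω) zⁿ | ω ∈ 𝒜 j}`.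
-/

/-- The multiplication of the trivial extension `S ⊕ S^{σ̄}`. -/
def trivMulTE {S : Type*} [Ring S] (σbar : S → S) (p q : S × S) : S × S :=
  (p.1 * q.1, p.1 * q.2 + p.2 * σbar q.1)

/-- The degree-`j` part `S_j = (Ω^j R)[z]` of `S = ΩR[z;σ]`. -/
noncomputable def sdeg {F Ω S : Type*} [Field F] [Ring Ω] [Algebra F Ω] [Ring S]
    [Algebra F S] (𝒜 : ℕ → Submodule F Ω) (ι : Ω →ₐ[F] S) (z : S) (j : ℕ) :
    Submodule F S :=
  Submodule.span F {x : S | ∃ ω ∈ 𝒜 j, ∃ n : ℕ, x = ι ω * z ^ n}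

/-- The grading of `ΩA = S ⊕ S^{σ̄}`:
`Ω^0 A = S_0 × 0` and `Ω^{k+1} A = S_{k+1} × S_k` (`|(0, ν z^m)| = |ν| + 1`). -/
noncomputable def gradeTE {F Ω S : Type*} [Field F] [Ring Ω] [Algebra F Ω] [Ring S]
    [Algebra F S] (𝒜 : ℕ → Submodule F Ω) (ι : Ω →ₐ[F] S) (z : S) :
    ℕ → Submodule F (S × S)
  | 0 => (sdeg 𝒜 ι z 0).prod ⊥
  | k + 1 => (sdeg 𝒜 ι z (k + 1)).prod (sdeg 𝒜 ι z k)

set_option maxHeartbeats 2000000 in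
theorem stmt12 {F Ω S : Type*} [Field F] [Ring Ω] [Algebra F Ω] [Ring S] [Algebra F S]
    (𝒜 : ℕ → Submodule F Ω) (hinternal : DirectSum.IsInternal 𝒜)
    (hone : (1 : Ω) ∈ 𝒜 0)
    (hmul : ∀ i j : ℕ, ∀ a ∈ 𝒜 i, ∀ b ∈ 𝒜 j, a * b ∈ 𝒜 (i + j))
    (d : Ω →ₗ[F] Ω) (N : ℕ)
    (hd_deg : ∀ n : ℕ, ∀ a ∈ 𝒜 n, d a ∈ 𝒜 (n + 1))
    (hd_sq : ∀ a : Ω, d (d a) = 0)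
    (hleibniz : ∀ i : ℕ, ∀ a ∈ 𝒜 i, ∀ b : Ω,
      d (a * b) = d a * b + ((-1 : F) ^ i) • (a * d b))
    (hdensity : ∀ n : ℕ,
      𝒜 (n + 1) = Submodule.span F {x : Ω | ∃ a ∈ 𝒜 n, ∃ r ∈ 𝒜 0, x = a * d r})
    (htop : ∀ n : ℕ, N < n → 𝒜 n = ⊥) (hN : 𝒜 N ≠ ⊥)
    (σ : Ω ≃ₐ[F] Ω)
    (hσdeg : ∀ n : ℕ, ∀ a ∈ 𝒜 n, σ a ∈ 𝒜 n ∧ σ.symm a ∈ 𝒜 n)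
    (hσd : ∀ a : Ω, σ (d a) = d (σ a))
    -- the skew polynomial ring `S = ΩR[z;σ]`
    (ι : Ω →ₐ[F] S) (z : S)
    (hcomm : ∀ ω : Ω, z * ι ω = ι (σ ω) * z)
    (hrep : ∀ s : S, ∃! c : ℕ →₀ Ω, s = c.sum fun i ω => ι ω * z ^ i)
    -- the automorphism `σ̄` of `S`
    (σbar : S ≃ₐ[F] S)
    (hσbar : ∀ (i n : ℕ), ∀ ω ∈ 𝒜 i,
      σbar (ι ω * z ^ n) = ((-1 : F) ^ i) • (ι (σ ω) * z ^ n)) :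
    -- the trivial extension `ΩA = S ⊕ S^{σ̄}` is an `(N+1)`-dimensional differential
    -- calculus on `A = R[z;σ]`
    ∃ D : (S × S) →ₗ[F] (S × S),
      -- `d(ω zⁿ, 0) = (d(ω) zⁿ, (−1)^{|ω|} ω ∂_z(zⁿ))`
      (∀ (i n : ℕ), ∀ ω ∈ 𝒜 i,
        D (ι ω * z ^ n, (0 : S))
          = (ι (d ω) * z ^ n, ((-1 : F) ^ i) • (n • (ι ω * z ^ (n - 1))))) ∧
      -- `d(0, ν z^m) = (0, d(ν) z^m)`
      (∀ (ν : Ω) (m : ℕ), D ((0 : S), ι ν * z ^ m) = ((0 : S), ι (d ν) * z ^ m)) ∧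
      -- `d` is square-zero
      (∀ x : S × S, D (D x) = 0) ∧
      -- `d` has degree one
      (∀ k : ℕ, ∀ x ∈ gradeTE 𝒜 ι z k, D x ∈ gradeTE 𝒜 ι z (k + 1)) ∧
      -- graded Leibniz rule
      (∀ k : ℕ, ∀ x ∈ gradeTE 𝒜 ι z k, ∀ y : S × S,
        D (trivMulTE σbar x y)
          = trivMulTE σbar (D x) y + ((-1 : F) ^ k) • trivMulTE σbar x (D y)) ∧
      -- the trivial extension is an associative unital algebra
      (∀ x y w : S × S,
        trivMulTE σbar (trivMulTE σbar x y) w = trivMulTE σbar x (trivMulTE σbar y w)) ∧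
      (∀ x : S × S, trivMulTE σbar ((1 : S), (0 : S)) x = x) ∧
      (∀ x : S × S, trivMulTE σbar x ((1 : S), (0 : S)) = x) ∧
      (∀ k l : ℕ, ∀ x ∈ gradeTE 𝒜 ι z k, ∀ y ∈ gradeTE 𝒜 ι z l,
        trivMulTE σbar x y ∈ gradeTE 𝒜 ι z (k + l)) ∧
      -- density
      (∀ k : ℕ, gradeTE 𝒜 ι z (k + 1) = Submodule.span F
        {w : S × S | ∃ p ∈ gradeTE 𝒜 ι z k, ∃ a ∈ gradeTE 𝒜 ι z 0,
          w = trivMulTE σbar p (D a)}) ∧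
      -- dimension `N + 1`
      gradeTE 𝒜 ι z (N + 1) ≠ ⊥ ∧
      (∀ n : ℕ, N + 1 < n → gradeTE 𝒜 ι z n = ⊥) := by
  classical
  -- the coordinate isomorphism
  let L : (ℕ →₀ Ω) →ₗ[F] S :=
    Finsupp.lsum F (fun i => (LinearMap.mulRight F (z ^ i)).comp ι.toLinearMap)
  have hL : ∀ c : ℕ →₀ Ω, L c = c.sum fun i ω => ι ω * z ^ i := fun c => by
    simp only [L, Finsupp.lsum_apply]
    rfl
  have hLbij : Function.Bijective L := by
    constructor
    · intro a b hab
      obtain ⟨c, _, hc⟩ := hrep (L a)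
      rw [hc a (hL a), hc b (by rw [hab]; exact hL b)]
    · intro s
      obtain ⟨c, hc, _⟩ := hrep s
      exact ⟨c, by rw [hL]; exact hc.symm⟩
  let e : (ℕ →₀ Ω) ≃ₗ[F] S := LinearEquiv.ofBijective L hLbij
  have hes : ∀ (n : ℕ) (ω : Ω), e.symm (ι ω * z ^ n) = Finsupp.single n ω := by
    intro n ω
    rw [LinearEquiv.symm_apply_eq]
    change _ = L _
    simp [L]
  let dS : S →ₗ[F] S := (Finsupp.lsum F (fun i : ℕ =>
    ((LinearMap.mulRight F (z ^ i)).comp ι.toLinearMap).comp d)).comp e.symm.toLinearMap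
  have hdS : ∀ (n : ℕ) (ω : Ω), dS (ι ω * z ^ n) = ι (d ω) * z ^ n := by
    intro n ω
    simp [dS, hes]
  let P : S →ₗ[F] S := (Finsupp.lsum F (fun i : ℕ =>
    (i • (LinearMap.mulRight F (z ^ (i - 1))).comp
      (σbar.toLinearMap.comp (ι.toLinearMap.comp σ.symm.toLinearMap)) : Ω →ₗ[F] S))).comp
        e.symm.toLinearMap
  have hP : ∀ (i n : ℕ), ∀ ω ∈ 𝒜 i,
      P (ι ω * z ^ n) = ((-1 : F) ^ i) • (n • (ι ω * z ^ (n - 1))) := by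
    intro i n ω hω
    have h1 := hσbar i 0 (σ.symm ω) (hσdeg i ω hω).2
    simp only [pow_zero, mul_one, AlgEquiv.apply_symm_apply] at h1
    have : P (ι ω * z ^ n) = n • (σbar (ι (σ.symm ω)) * z ^ (n - 1)) := by
      simp [P, hes]
    rw [this, h1, smul_mul_assoc, smul_comm]
  clear_value dS P
  -- generators
  have hgen : ∀ i n : ℕ, ∀ ω ∈ 𝒜 i, ι ω * z ^ n ∈ sdeg 𝒜 ι z i :=
    fun i n ω hω => Submodule.subset_span ⟨ω, hω, n, rfl⟩
  have hindj : ∀ (j : ℕ) (Q : Submodule F S),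
      (∀ n : ℕ, ∀ ω ∈ 𝒜 j, ι ω * z ^ n ∈ Q) → sdeg 𝒜 ι z j ≤ Q := by
    intro j Q h
    refine Submodule.span_le.2 ?_
    rintro x ⟨ω, hω, n, rfl⟩
    exact h n ω hω
  have hind : ∀ (Q : Submodule F S),
      (∀ i n : ℕ, ∀ ω ∈ 𝒜 i, ι ω * z ^ n ∈ Q) → ∀ s, s ∈ Q := by
    intro Q h s
    obtain ⟨c, rfl⟩ := hLbij.2 s
    rw [hL]
    refine Submodule.sum_mem _ fun n _ => ?_
    have htopΩ : (⊤ : Submodule F Ω) ≤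
        Q.comap ((LinearMap.mulRight F (z ^ n)).comp ι.toLinearMap) := by
      rw [← hinternal.submodule_iSup_eq_top]
      exact iSup_le fun i ω hω => h i n ω hω
    exact htopΩ (Submodule.mem_top : c n ∈ ⊤)
  have hext : ∀ (f g : S →ₗ[F] S),
      (∀ i n : ℕ, ∀ ω ∈ 𝒜 i, f (ι ω * z ^ n) = g (ι ω * z ^ n)) → ∀ s, f s = g s :=
    fun f g h s => hind (LinearMap.eqLocus f g) (fun i n ω hω => h i n ω hω) s
  have hextj : ∀ (j : ℕ) (f g : S →ₗ[F] S),
      (∀ n : ℕ, ∀ ω ∈ 𝒜 j, f (ι ω * z ^ n) = g (ι ω * z ^ n)) →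
        ∀ s ∈ sdeg 𝒜 ι z j, f s = g s :=
    fun j f g h s hs => hindj j (LinearMap.eqLocus f g) (fun n ω hω => h n ω hω) hs
  -- iterates of σ
  have hσn : ∀ (n i : ℕ), ∀ ω ∈ 𝒜 i, (σ ^ n) ω ∈ 𝒜 i ∧ (σ ^ n).symm ω ∈ 𝒜 i := by
    intro n
    induction n with
    | zero => intro i ω hω; exact ⟨hω, hω⟩
    | succ n ih =>
      intro i ω hω
      constructor
      · rw [pow_succ]
        exact (ih i _ (hσdeg i ω hω).1).1
      · have : (σ ^ (n + 1)).symm ω = (σ ^ n).symm (σ.symm ω) := by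
          rw [AlgEquiv.symm_apply_eq, pow_succ']
          simp [AlgEquiv.mul_apply]
        rw [this]
        exact (ih i _ (hσdeg i ω hω).2).2
  have hσnd : ∀ (n : ℕ) (ω : Ω), (σ ^ n) (d ω) = d ((σ ^ n) ω) := by
    intro n
    induction n with
    | zero => intro ω; rfl
    | succ n ih =>
      intro ω
      rw [pow_succ, AlgEquiv.mul_apply, AlgEquiv.mul_apply, hσd, ih]
  have hzn : ∀ (n : ℕ) (ω : Ω), z ^ n * ι ω = ι ((σ ^ n) ω) * z ^ n := by
    intro n
    induction n with
    | zero => intro ω; simp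
    | succ n ih =>
      intro ω
      rw [pow_succ z, mul_assoc, hcomm, ← mul_assoc, ih, mul_assoc, pow_succ σ,
        AlgEquiv.mul_apply]
  have hprod : ∀ (ω ν : Ω) (n m : ℕ),
      (ι ω * z ^ n) * (ι ν * z ^ m) = ι (ω * (σ ^ n) ν) * z ^ (n + m) := by
    intro ω ν n m
    rw [mul_assoc, ← mul_assoc (z ^ n), hzn, map_mul, pow_add]
    simp only [mul_assoc]
  -- basic identities
  have hdd : ∀ s, dS (dS s) = 0 := by
    refine hext (dS.comp dS) 0 fun i n ω hω => ?_
    simp [hdS, hd_sq]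
  have hPd : ∀ s, P (dS s) + dS (P s) = 0 := by
    refine hext (P.comp dS + dS.comp P) 0 fun i n ω hω => ?_
    simp only [LinearMap.add_apply, LinearMap.comp_apply, LinearMap.zero_apply]
    rw [hdS, hP (i + 1) n _ (hd_deg i ω hω), hP i n ω hω, map_smul, map_nsmul, hdS, pow_succ]
    simp
  have hdσ : ∀ t, dS (σbar t) = - σbar (dS t) := by
    refine hext (dS.comp σbar.toLinearMap) (-(σbar.toLinearMap.comp dS)) fun i n ω hω => ?_
    simp only [LinearMap.neg_apply, LinearMap.comp_apply, AlgEquiv.toLinearMap_apply]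
    rw [hdS, hσbar i n ω hω, hσbar (i + 1) n _ (hd_deg i ω hω), map_smul, hdS, hσd, pow_succ]
    simp
  have hσdegS : ∀ j, ∀ s ∈ sdeg 𝒜 ι z j, σbar s ∈ sdeg 𝒜 ι z j := by
    intro j
    refine hindj j ((sdeg 𝒜 ι z j).comap σbar.toLinearMap) fun n ω hω => ?_
    rw [Submodule.mem_comap, AlgEquiv.toLinearMap_apply]
    rw [hσbar j n ω hω]
    exact Submodule.smul_mem _ _ (hgen j n _ (hσdeg j ω hω).1)
  have hddeg : ∀ j, ∀ s ∈ sdeg 𝒜 ι z j, dS s ∈ sdeg 𝒜 ι z (j + 1) := by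
    intro j
    refine hindj j ((sdeg 𝒜 ι z (j + 1)).comap dS) fun n ω hω => ?_
    rw [Submodule.mem_comap]
    rw [hdS]
    exact hgen _ n _ (hd_deg j ω hω)
  have hPdeg : ∀ j, ∀ s ∈ sdeg 𝒜 ι z j, P s ∈ sdeg 𝒜 ι z j := by
    intro j
    refine hindj j ((sdeg 𝒜 ι z j).comap P) fun n ω hω => ?_
    rw [Submodule.mem_comap]
    rw [hP j n ω hω]
    exact Submodule.smul_mem _ _ (nsmul_mem (hgen j _ ω hω) n)
  have hmulS : ∀ i j, ∀ s ∈ sdeg 𝒜 ι z i, ∀ t ∈ sdeg 𝒜 ι z j,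
      s * t ∈ sdeg 𝒜 ι z (i + j) := by
    intro i j s hs t ht
    revert s
    refine hindj i ((sdeg 𝒜 ι z (i + j)).comap (LinearMap.mulRight F t)) fun n ω hω => ?_
    rw [Submodule.mem_comap, LinearMap.mulRight_apply]
    revert t
    refine hindj j ((sdeg 𝒜 ι z (i + j)).comap (LinearMap.mulLeft F (ι ω * z ^ n)))
      fun m ν hν => ?_
    rw [Submodule.mem_comap, LinearMap.mulLeft_apply]
    rw [hprod]
    exact hgen _ _ _ (hmul i j ω hω _ (hσn n j ν hν).1)
  have hleib1 : ∀ i, ∀ s ∈ sdeg 𝒜 ι z i, ∀ t,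
      dS (s * t) = dS s * t + ((-1 : F) ^ i) • (s * dS t) := by
    intro i s hs t
    refine hextj i (dS.comp (LinearMap.mulRight F t))
      ((LinearMap.mulRight F t).comp dS + ((-1 : F) ^ i) • LinearMap.mulRight F (dS t))
      (fun n ω hω => ?_) s hs
    refine hext (dS.comp (LinearMap.mulLeft F (ι ω * z ^ n)))
      (LinearMap.mulLeft F (dS (ι ω * z ^ n)) +
        ((-1 : F) ^ i) • (LinearMap.mulLeft F (ι ω * z ^ n)).comp dS)
      (fun j m ν hν => ?_) t
    simp only [LinearMap.comp_apply, LinearMap.add_apply, LinearMap.smul_apply,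
      LinearMap.mulLeft_apply]
    rw [hprod, hdS, hdS, hdS, hprod, hprod, hleibniz i ω hω, hσnd, map_add, map_smul, add_mul,
      smul_mul_assoc]
  have hleib2 : ∀ i, ∀ s ∈ sdeg 𝒜 ι z i, ∀ t,
      P (s * t) = P s * σbar t + ((-1 : F) ^ i) • (s * P t) := by
    intro i s hs t
    refine hextj i (P.comp (LinearMap.mulRight F t))
      ((LinearMap.mulRight F (σbar t)).comp P + ((-1 : F) ^ i) • LinearMap.mulRight F (P t))
      (fun n ω hω => ?_) s hs
    refine hext (P.comp (LinearMap.mulLeft F (ι ω * z ^ n)))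
      ((LinearMap.mulLeft F (P (ι ω * z ^ n))).comp σbar.toLinearMap +
        ((-1 : F) ^ i) • (LinearMap.mulLeft F (ι ω * z ^ n)).comp P)
      (fun j m ν hν => ?_) t
    simp only [LinearMap.comp_apply, LinearMap.add_apply, LinearMap.smul_apply,
      LinearMap.mulLeft_apply, AlgEquiv.toLinearMap_apply]
    rw [hprod, hP (i + j) _ _ (hmul i j ω hω _ (hσn n j ν hν).1), hP i n ω hω, hP j m ν hν,
      hσbar j m ν hν]
    simp only [smul_mul_assoc, mul_smul_comm, hprod]
    have e1 : n • (ι (ω * (σ ^ (n - 1)) (σ ν)) * z ^ (n - 1 + m))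
        = n • (ι (ω * (σ ^ n) ν) * z ^ (n + m - 1)) := by
      rcases n with _ | n
      · simp
      · rw [pow_succ σ, AlgEquiv.mul_apply]
        congr 3
        omega
    have e2 : m • (ι (ω * (σ ^ n) ν) * z ^ (n + (m - 1)))
        = m • (ι (ω * (σ ^ n) ν) * z ^ (n + m - 1)) := by
      rcases m with _ | m
      · simp
      · rfl
    rw [smul_comm ((-1 : F) ^ j) ((-1 : F) ^ i), e1, e2, add_smul, smul_add, smul_smul, smul_smul,
      pow_add]
  have hg0 : ∀ s m : S, (s, m) ∈ gradeTE 𝒜 ι z 0 ↔ s ∈ sdeg 𝒜 ι z 0 ∧ m = 0 := by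
    intro s m
    rw [gradeTE, Submodule.mem_prod, Submodule.mem_bot]
  have hgs : ∀ (k : ℕ) (s m : S), (s, m) ∈ gradeTE 𝒜 ι z (k + 1) ↔
      s ∈ sdeg 𝒜 ι z (k + 1) ∧ m ∈ sdeg 𝒜 ι z k := by
    intro k s m
    rw [gradeTE, Submodule.mem_prod]
  let D : (S × S) →ₗ[F] (S × S) :=
    (dS.comp (LinearMap.fst F S S)).prod
      (P.comp (LinearMap.fst F S S) + dS.comp (LinearMap.snd F S S))
  have hD : ∀ s m, D (s, m) = (dS s, P s + dS m) := fun s m => rfl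
  clear_value D
  have hDdeg : ∀ k : ℕ, ∀ x ∈ gradeTE 𝒜 ι z k, D x ∈ gradeTE 𝒜 ι z (k + 1) := by
    rintro k ⟨s, m⟩ hx
    rw [hD]
    rcases k with _ | k
    · obtain ⟨h1, rfl⟩ := (hg0 _ _).1 hx
      refine (hgs _ _ _).2 ⟨hddeg _ _ h1, ?_⟩
      simpa using hPdeg _ _ h1
    · obtain ⟨h1, h2⟩ := (hgs _ _ _).1 hx
      exact (hgs _ _ _).2 ⟨hddeg _ _ h1, add_mem (hPdeg _ _ h1) (hddeg _ _ h2)⟩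
  have hTdeg : ∀ k l : ℕ, ∀ x ∈ gradeTE 𝒜 ι z k, ∀ y ∈ gradeTE 𝒜 ι z l,
        trivMulTE σbar x y ∈ gradeTE 𝒜 ι z (k + l) := by
    rintro k l ⟨s, m⟩ hx ⟨s', m'⟩ hy
    rw [trivMulTE]
    dsimp only
    rcases k with _ | k
    · obtain ⟨h1, rfl⟩ := (hg0 _ _).1 hx
      rcases l with _ | l
      · obtain ⟨h3, rfl⟩ := (hg0 _ _).1 hy
        exact (hg0 _ _).2 ⟨hmulS 0 0 _ h1 _ h3, by simp⟩
      · obtain ⟨h3, h4⟩ := (hgs _ _ _).1 hy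
        have a := hmulS _ _ _ h1 _ h3
        have b := hmulS _ _ _ h1 _ h4
        rw [zero_add] at a b ⊢
        rw [zero_mul, add_zero]
        exact (hgs _ _ _).2 ⟨a, b⟩
    · obtain ⟨h1, h2⟩ := (hgs _ _ _).1 hx
      rcases l with _ | l
      · obtain ⟨h3, rfl⟩ := (hg0 _ _).1 hy
        have a := hmulS _ _ _ h1 _ h3
        have b := hmulS _ _ _ h2 _ (hσdegS _ _ h3)
        rw [add_zero] at a b ⊢
        rw [mul_zero, zero_add]
        exact (hgs _ _ _).2 ⟨a, b⟩
      · obtain ⟨h3, h4⟩ := (hgs _ _ _).1 hy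
        have a := hmulS _ _ _ h1 _ h3
        have b := hmulS _ _ _ h1 _ h4
        have c := hmulS _ _ _ h2 _ (hσdegS _ _ h3)
        have e1 : k + 1 + (l + 1) = (k + 1 + l) + 1 := by omega
        have e2 : k + (l + 1) = k + 1 + l := by omega
        rw [e1] at a ⊢
        rw [e2] at c
        exact (hgs _ _ _).2 ⟨a, add_mem b c⟩
  have hd1 : d 1 = 0 := by
    have := hleibniz 0 1 hone 1
    simpa using this
  refine ⟨D, ?_, ?_, ?_, hDdeg, ?_, ?_, ?_, ?_, hTdeg, ?_, ?_, ?_⟩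
  · intro i n ω hω
    rw [hD, hdS, hP i n ω hω, map_zero, add_zero]
  · intro ν m
    rw [hD, hdS, map_zero, map_zero, zero_add]
  · rintro ⟨s, m⟩
    rw [hD, hD, hdd, map_add, hdd, add_zero, hPd]
    rfl
  · rintro k ⟨s, m⟩ hx ⟨s', m'⟩
    have key : s ∈ sdeg 𝒜 ι z k ∧ dS (m * σbar s') =
        dS m * σbar s' + ((-1 : F) ^ k) • (m * σbar (dS s')) := by
      rcases k with _ | k
      · obtain ⟨h1, rfl⟩ := (hg0 _ _).1 hx
        exact ⟨h1, by simp⟩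
      · obtain ⟨h1, h2⟩ := (hgs _ _ _).1 hx
        refine ⟨h1, ?_⟩
        rw [hleib1 k m h2, hdσ, pow_succ]
        simp
    obtain ⟨hs, hm⟩ := key
    simp only [trivMulTE, hD]
    refine Prod.ext ?_ ?_
    · simpa using hleib1 k s hs s'
    · simp only [Prod.snd_add, Prod.smul_snd]
      rw [hleib2 k s hs, map_add, hleib1 k s hs, hm]
      simp only [mul_add, add_mul, smul_add]
      abel
  · rintro ⟨a, b⟩ ⟨a', b'⟩ ⟨a'', b''⟩
    simp only [trivMulTE, map_mul, mul_add, add_mul, mul_assoc, add_assoc]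
  · rintro ⟨a, b⟩
    simp [trivMulTE]
  · rintro ⟨a, b⟩
    simp [trivMulTE]
  · intro k
    have h0mem : ∀ s ∈ sdeg 𝒜 ι z 0, (s, (0 : S)) ∈ gradeTE 𝒜 ι z 0 := fun s hs =>
      (hg0 _ _).2 ⟨hs, rfl⟩
    have hkmem : ∀ s ∈ sdeg 𝒜 ι z k, (s, (0 : S)) ∈ gradeTE 𝒜 ι z k := by
      intro s hs
      rcases k with _ | k
      · exact h0mem s hs
      · exact (hgs _ _ _).2 ⟨hs, zero_mem _⟩
    refine le_antisymm ?_ (Submodule.span_le.2 ?_)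
    · set W := Submodule.span F {w : S × S | ∃ p ∈ gradeTE 𝒜 ι z k, ∃ a ∈ gradeTE 𝒜 ι z 0,
          w = trivMulTE σbar p (D a)} with hW
      have hsnd : ∀ t ∈ sdeg 𝒜 ι z k, ((0 : S), t) ∈ W := by
        intro t ht
        have hz : z ∈ sdeg 𝒜 ι z 0 := by simpa using hgen 0 1 1 hone
        refine Submodule.subset_span ⟨(t, 0), hkmem t ht, (z, 0), h0mem z hz, ?_⟩
        have a1 : dS z = 0 := by simpa [hd1] using hdS 1 1
        have a2 : P z = 1 := by simpa using hP 0 1 1 hone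
        simp [trivMulTE, hD, a1, a2]
      have hfst : ∀ t ∈ sdeg 𝒜 ι z (k + 1), (t, (0 : S)) ∈ W := by
        refine hindj (k + 1) (W.comap (LinearMap.inl F S S)) fun n ω hω => ?_
        rw [hdensity] at hω
        have : Submodule.span F {x : Ω | ∃ a ∈ 𝒜 k, ∃ r ∈ 𝒜 0, x = a * d r} ≤
            (W.comap (LinearMap.inl F S S)).comap
              ((LinearMap.mulRight F (z ^ n)).comp ι.toLinearMap) := by
          refine Submodule.span_le.2 ?_
          rintro x ⟨a, ha, r, hr, rfl⟩
          have hr' := (hσn n 0 r hr).2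
          have hr0 : ι ((σ ^ n).symm r) ∈ sdeg 𝒜 ι z 0 := by simpa using hgen 0 0 _ hr'
          change (ι (a * d r) * z ^ n, (0 : S)) ∈ W
          refine Submodule.subset_span ⟨(ι a * z ^ n, 0), hkmem _ (hgen k n a ha),
            (ι ((σ ^ n).symm r), 0), h0mem _ hr0, ?_⟩
          have a1 : dS (ι ((σ ^ n).symm r)) = ι (d ((σ ^ n).symm r)) := by
            simpa using hdS 0 ((σ ^ n).symm r)
          have a2 : P (ι ((σ ^ n).symm r)) = 0 := by
            simpa using hP 0 0 _ hr'
          have a3 := hprod a (d ((σ ^ n).symm r)) n 0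
          rw [hσnd, AlgEquiv.apply_symm_apply, pow_zero, mul_one, add_zero] at a3
          simp only [trivMulTE, hD, a1, a2, a3]
          simp
        exact this hω
      rintro ⟨s, t⟩ hx
      obtain ⟨h1, h2⟩ := (hgs _ _ _).1 hx
      have := add_mem (hfst s h1) (hsnd t h2)
      simpa using this
    · rintro w ⟨p, hp, a, ha, rfl⟩
      exact hTdeg k 1 p hp _ (hDdeg 0 a ha)
  · intro hbot
    obtain ⟨ω, hω, hne⟩ := (Submodule.ne_bot_iff _).1 hN
    have hmem : ((0 : S), ι ω * z ^ 0) ∈ gradeTE 𝒜 ι z (N + 1) :=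
      (hgs _ _ _).2 ⟨zero_mem _, hgen N 0 ω hω⟩
    rw [hbot, Submodule.mem_bot] at hmem
    have h0 : ι ω * z ^ 0 = 0 := congrArg Prod.snd hmem
    have h1 := hes 0 ω
    rw [h0, map_zero] at h1
    exact hne (Finsupp.single_eq_zero.1 h1.symm)
  · intro n hn
    have hsb : ∀ j, N < j → sdeg 𝒜 ι z j = ⊥ := by
      intro j hj
      refine le_bot_iff.1 (hindj j ⊥ fun n ω hω => ?_)
      rw [htop j hj, Submodule.mem_bot] at hω
      simp [hω]
    rcases n with _ | n
    · omega
    · change (sdeg 𝒜 ι z (n + 1)).prod (sdeg 𝒜 ι z n) = ⊥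
      rw [hsb _ (by omega), hsb _ (by omega), Submodule.prod_bot]
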